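/- Let λ₁,…,λ_m be positive real numbers and μ ∈ ℝ^m, and set f = (μ_k/√λ_k)_{k=1}^m and g = (1/√λ_k)_{k=1}^m in ℝ^m. Then ⟨D(λ₁,…,λ_m)⁻¹ μ, μ⟩ = (Γ(f) + Γ(f,g)) / (Γ(g) + 1), where Γ(f) = ‖f‖², Γ(g) = ‖g‖², and Γ(f,g) = ‖f‖²‖g‖² − ⟨f,g⟩² is the Gram determinant of f and g. -/

import Mathlib

open Matrix

/-- The Sherman–Morrison formula for the all-ones matrix plus a diagonal matrix. -/
theorem inv_allOnes_add_diagonal {n K : Type*} [Fintype n] [DecidableEq n] [Field K]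
    {d : n → K} (hd : ∀ k, d k ≠ 0) (hs : ∑ k, (d k)⁻¹ + 1 ≠ 0) :
    ((Matrix.of fun _ _ : n => (1 : K)) + Matrix.diagonal d)⁻¹ =
      Matrix.diagonal (fun k => (d k)⁻¹) -
        Matrix.of fun i j => (d i)⁻¹ * (d j)⁻¹ / (∑ k, (d k)⁻¹ + 1) := by
  apply Matrix.inv_eq_right_inv
  ext i j
  have hsum : ∑ k, (d k)⁻¹ * (d j)⁻¹ / (∑ k, (d k)⁻¹ + 1) =
      (∑ k, (d k)⁻¹) * (d j)⁻¹ / (∑ k, (d k)⁻¹ + 1) := by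
    rw [Finset.sum_mul, Finset.sum_div]
  have hdi := hd i
  have hdj := hd j
  rw [mul_sub, add_mul, add_mul]
  rw [Matrix.sub_apply, Matrix.add_apply, Matrix.add_apply, Matrix.mul_diagonal,
    Matrix.diagonal_mul_diagonal, Matrix.diagonal_mul, Matrix.mul_apply]
  simp only [Matrix.of_apply, one_mul, hsum, mul_inv_cancel₀ (hd _), Matrix.diagonal_one]
  generalize ∑ k, (d k)⁻¹ = s at hs ⊢
  field_simp
  ring

/-- The quadratic form of the inverse of the all-ones matrix plus a diagonal matrix. -/
theorem inv_allOnes_add_diagonal_mulVec_dotProduct {n K : Type*} [Fintype n] [DecidableEq n]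
    [Field K] {d : n → K} (hd : ∀ k, d k ≠ 0) (hs : ∑ k, (d k)⁻¹ + 1 ≠ 0) (v : n → K) :
    (((Matrix.of fun _ _ : n => (1 : K)) + Matrix.diagonal d)⁻¹).mulVec v ⬝ᵥ v =
      ∑ k, v k ^ 2 / d k - (∑ k, v k / d k) ^ 2 / (∑ k, (d k)⁻¹ + 1) := by
  rw [inv_allOnes_add_diagonal hd hs, Matrix.sub_mulVec, sub_dotProduct]
  congr 1
  · simp only [dotProduct, Matrix.mulVec_diagonal]
    exact Finset.sum_congr rfl fun k _ => by ring
  · simp only [dotProduct, Matrix.mulVec, Matrix.of_apply]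
    rw [sq, Finset.sum_mul_sum, Finset.sum_div]
    refine Finset.sum_congr rfl fun i _ => ?_
    rw [Finset.sum_mul, Finset.sum_div]
    exact Finset.sum_congr rfl fun j _ => by ring

/-- For positive `λ_k`, with `f_k = μ_k/√λ_k` and `g_k = 1/√λ_k`,
`⟨D(λ)⁻¹ μ, μ⟩ = (Γ(f) + Γ(f,g))/(Γ(g) + 1)` where `Γ(f) = ‖f‖²`,
`Γ(f,g) = ‖f‖²‖g‖² − ⟨f,g⟩²`. -/
theorem inv_allOnes_add_diagonal_quadratic_form_gram
    (m : ℕ) (lam : Fin m → ℝ) (hlam : ∀ k, 0 < lam k) (μ : Fin m → ℝ)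
    (f g : Fin m → ℝ)
    (hf : ∀ k, f k = μ k / Real.sqrt (lam k))
    (hg : ∀ k, g k = 1 / Real.sqrt (lam k)) :
    (((Matrix.of fun _ _ : Fin m => (1 : ℝ)) + Matrix.diagonal lam)⁻¹).mulVec μ ⬝ᵥ μ =
      ((∑ k, f k ^ 2) +
          ((∑ k, f k ^ 2) * (∑ k, g k ^ 2) - (∑ k, f k * g k) ^ 2)) /
        ((∑ k, g k ^ 2) + 1) := by
  have hff (k) : f k ^ 2 = μ k ^ 2 / lam k := by
    rw [hf, div_pow, Real.sq_sqrt (hlam k).le]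
  have hgg (k) : g k ^ 2 = (lam k)⁻¹ := by
    rw [hg, div_pow, Real.sq_sqrt (hlam k).le, one_pow, one_div]
  have hfg (k) : f k * g k = μ k / lam k := by
    rw [hf, hg, div_mul_div_comm, Real.mul_self_sqrt (hlam k).le, mul_one]
  have hs : ∑ k, (lam k)⁻¹ + 1 ≠ 0 :=
    (add_pos_of_nonneg_of_pos
      (Finset.sum_nonneg fun k _ => (inv_pos.2 (hlam k)).le) one_pos).ne'
  rw [inv_allOnes_add_diagonal_mulVec_dotProduct (fun k => (hlam k).ne') hs]
  simp only [hff, hgg, hfg]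
  rw [eq_div_iff hs, sub_mul, div_mul_cancel₀ _ hs]
  ring
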